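/- For every prime power q and every integer k ≥ 2, there exists a set C of k-dimensional subspaces of F_q^{2k} with |C| = q^{2k} + 1 such that any two distinct members U, W of C satisfy d_s(U,W) ≥ 2k − 2 (equivalently, dim(U ∩ W) ≤ 1). In particular, A_q(2k, 2k−2; k) ≥ q^{2k} + 1. -/

import Mathlib

open Module

/-- The subspace distance `d_s(U,W) = dim(U + W) - dim(U ∩ W)`. -/
noncomputable def sDist {K V : Type*} [DivisionRing K] [AddCommGroup V] [Module K V]
    (U W : Submodule K V) : ℕ :=
  finrank K ↥(U ⊔ W) - finrank K ↥(U ⊓ W)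

open Polynomial

/-- The linearized polynomial map `x ↦ a * x + b * x ^ #K` on an extension `L` of a finite field
`K`, as a `K`-linear map. -/
noncomputable def linearizedMap (K : Type*) {L : Type*} [Field K] [Fintype K] [Field L]
    [Algebra K L] (a b : L) : L →ₗ[K] L :=
  LinearMap.mulLeft K a + LinearMap.mulLeft K b ∘ₗ (FiniteField.frobeniusAlgHom K L).toLinearMap

section

variable {K L : Type*} [Field K] [Fintype K] [Field L] [Algebra K L]

theorem linearizedMap_apply (a b x : L) :
    linearizedMap K a b x = a * x + b * x ^ Fintype.card K := rfl

theorem linearizedMap_sub (a b a' b' : L) :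
    linearizedMap K a b - linearizedMap K a' b' = linearizedMap K (a - a') (b - b') := by
  ext x
  simp only [LinearMap.sub_apply, linearizedMap_apply]
  ring

/-- A nonzero linearized polynomial of `#K`-degree at most one has at most `#K` roots, so that its
kernel is at most one-dimensional. -/
theorem finrank_ker_linearizedMap_le_one [Finite L] {a b : L} (h : (a, b) ≠ 0) :
    finrank K (LinearMap.ker (linearizedMap K a b)) ≤ 1 := by
  classical
  have hq : 1 < Fintype.card K := Fintype.one_lt_card
  set p : L[X] := C a * X + C b * X ^ Fintype.card K with hp
  have hp0 : p ≠ 0 := by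
    intro h0
    have ha : p.coeff 1 = 0 := by rw [h0, coeff_zero]
    have hb : p.coeff (Fintype.card K) = 0 := by rw [h0, coeff_zero]
    simp only [hp, coeff_add, coeff_C_mul, coeff_X_pow, coeff_X, hq.ne, if_true, if_false,
      mul_one, mul_zero, add_zero, zero_add] at ha hb
    exact h (Prod.ext ha hb)
  have hdeg : p.natDegree ≤ Fintype.card K :=
    natDegree_add_le_of_degree_le ((natDegree_C_mul_le a X).trans (natDegree_X_le.trans hq.le))
      (natDegree_C_mul_X_pow_le b _)
  have hsub : (LinearMap.ker (linearizedMap K a b) : Set L) ⊆ (p.roots.toFinset : Set L) := by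
    intro x hx
    rw [SetLike.mem_coe, LinearMap.mem_ker, linearizedMap_apply] at hx
    rw [Finset.mem_coe, Multiset.mem_toFinset, mem_roots hp0]
    simpa [hp] using hx
  have hcard : Nat.card (LinearMap.ker (linearizedMap K a b)) ≤ Fintype.card K := by
    calc Nat.card (LinearMap.ker (linearizedMap K a b))
        = (LinearMap.ker (linearizedMap K a b) : Set L).ncard := Nat.card_coe_set_eq _
      _ ≤ (p.roots.toFinset : Set L).ncard := Set.ncard_le_ncard hsub
      _ = p.roots.toFinset.card := Set.ncard_coe_finset _
      _ ≤ Fintype.card K := (p.roots.toFinset_card_le.trans p.card_roots').trans hdeg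
  rw [Module.natCard_eq_pow_finrank (K := K), Nat.card_eq_fintype_card] at hcard
  exact (Nat.pow_le_pow_iff_right hq).mp (by simpa using hcard)

end

section

variable {K V W : Type*} [Field K] [AddCommGroup V] [Module K V] [AddCommGroup W] [Module K W]

theorem finrank_graph (f : V →ₗ[K] W) : finrank K f.graph = finrank K V := by
  rw [LinearMap.graph_eq_range_prod]
  exact LinearMap.finrank_range_of_inj fun x y h => congrArg Prod.fst h

theorem finrank_graph_inf_graph_le [FiniteDimensional K V] (f g : V →ₗ[K] W) :
    finrank K ↥(f.graph ⊓ g.graph) ≤ finrank K (LinearMap.ker (f - g)) := by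
  have hle : f.graph ⊓ g.graph ≤ (LinearMap.ker (f - g)).map (LinearMap.id.prod f) := by
    rintro ⟨x, y⟩ ⟨hf, hg⟩
    have hf : y = f x := hf
    have hg : y = g x := hg
    exact ⟨x, by simp [← hf, ← hg], by simp [hf]⟩
  exact (Submodule.finrank_mono hle).trans (Submodule.finrank_map_le _ _)

theorem graph_inf_range_inr (f : V →ₗ[K] W) :
    f.graph ⊓ LinearMap.range (LinearMap.inr K V W) = ⊥ := by
  rw [eq_bot_iff]
  rintro ⟨x, y⟩ ⟨hf, z, hz⟩
  obtain ⟨rfl, rfl⟩ := Prod.ext_iff.mp hz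
  have hf : z = f 0 := hf
  simp [hf]

theorem sDist_add_two_mul_finrank_inf [FiniteDimensional K V] (U U' : Submodule K V) :
    sDist U U' + 2 * finrank K ↥(U ⊓ U') = finrank K U + finrank K U' := by
  have hsum := Submodule.finrank_sup_add_finrank_inf_eq U U'
  have hle : finrank K ↥(U ⊓ U') ≤ finrank K ↥(U ⊔ U') :=
    Submodule.finrank_mono (inf_le_left.trans le_sup_left)
  unfold sDist
  omega

end

/-- The graphs of the linearized polynomial maps `x ↦ a * x + b * x ^ #K` on `L`, together with the
vertical subspace `0 × L`. -/
noncomputable def extendedLiftedCode (K L : Type*) [Field K] [Fintype K] [Field L] [Algebra K L] :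
    Option (L × L) → Submodule K (L × L)
  | none => LinearMap.range (LinearMap.inr K L L)
  | some c => (linearizedMap K c.1 c.2).graph

section

variable {K L : Type*} [Field K] [Fintype K] [Field L] [Algebra K L]

theorem finrank_extendedLiftedCode (i : Option (L × L)) :
    finrank K (extendedLiftedCode K L i) = finrank K L := by
  cases i with
  | none => exact LinearMap.finrank_range_of_inj LinearMap.inr_injective
  | some c => exact finrank_graph _

theorem finrank_extendedLiftedCode_inf_le_one [Finite L] {i j : Option (L × L)} (h : i ≠ j) :
    finrank K ↥(extendedLiftedCode K L i ⊓ extendedLiftedCode K L j) ≤ 1 := by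
  have : FiniteDimensional K L := .of_finite
  cases i with
  | none =>
    cases j with
    | none => exact absurd rfl h
    | some d =>
      rw [inf_comm, extendedLiftedCode, extendedLiftedCode, graph_inf_range_inr, finrank_bot]
      exact zero_le_one
  | some c =>
    cases j with
    | none =>
      rw [extendedLiftedCode, extendedLiftedCode, graph_inf_range_inr, finrank_bot]
      exact zero_le_one
    | some d =>
      refine (finrank_graph_inf_graph_le _ _).trans ?_
      rw [linearizedMap_sub]
      exact finrank_ker_linearizedMap_le_one fun h0 => h (congrArg some (sub_eq_zero.mp h0))

end

/-- A finite field has a finite extension of every positive degree. -/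
theorem exists_finite_extension (K : Type*) [Field K] [Finite K] (n : ℕ) (hn : n ≠ 0) :
    ∃ (L : Type) (_ : Field L) (_ : Algebra K L), Finite L ∧ finrank K L = n := by
  obtain ⟨p, hp⟩ := CharP.exists K
  have : Fact p.Prime := ⟨CharP.char_is_prime K p⟩
  have : NeZero n := ⟨hn⟩
  exact ⟨FiniteField.Extension K p n, inferInstance, inferInstance, inferInstance,
    FiniteField.finrank_extension K p n⟩

/-- `A_q(2k,2k-2;k) ≥ q^{2k} + 1`: there is a set of `q^{2k} + 1` many `k`-dimensional
subspaces of `F_q^{2k}` with pairwise subspace distance at least `2k - 2` (obtained from a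
lifted MRD code extended by one codeword). -/
theorem exists_large_cdc (K : Type*) [Field K] [Fintype K] (q k : ℕ)
    (hq : Fintype.card K = q) (hk : 2 ≤ k) :
    ∃ C : Set (Submodule K (Fin (2 * k) → K)),
      C.ncard = q ^ (2 * k) + 1 ∧
      (∀ U ∈ C, finrank K ↥U = k) ∧
      (∀ U ∈ C, ∀ W ∈ C, U ≠ W → 2 * k - 2 ≤ sDist U W) := by
  obtain ⟨L, _, _, _, hL⟩ := exists_finite_extension K k (by omega)
  have : FiniteDimensional K L := .of_finite
  have hLL : finrank K (L × L) = 2 * k := by rw [finrank_prod, hL, two_mul]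
  let e : (L × L) ≃ₗ[K] (Fin (2 * k) → K) :=
    LinearEquiv.ofFinrankEq _ _ (by rw [hLL, finrank_fin_fun])
  let S : Option (L × L) → Submodule K (Fin (2 * k) → K) := fun i =>
    (extendedLiftedCode K L i).map (e : (L × L) →ₗ[K] (Fin (2 * k) → K))
  have hdim (i) : finrank K (S i) = k := by
    rw [LinearEquiv.finrank_map_eq, finrank_extendedLiftedCode, hL]
  have hinf {i j} (h : i ≠ j) : finrank K ↥(S i ⊓ S j) ≤ 1 := by
    rw [← Submodule.map_inf _ e.injective, LinearEquiv.finrank_map_eq]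
    exact finrank_extendedLiftedCode_inf_le_one h
  have hS : Function.Injective S := by
    intro i j hij
    by_contra hne
    have h1 := hinf hne
    rw [← hij, inf_idem, hdim] at h1
    omega
  refine ⟨Set.range S, ?_, ?_, ?_⟩
  · rw [Set.ncard_range_of_injective hS, Finite.card_option,
      Module.natCard_eq_pow_finrank (K := K), hLL, Nat.card_eq_fintype_card, hq]
  · rintro _ ⟨i, rfl⟩
    exact hdim i
  · rintro _ ⟨i, rfl⟩ _ ⟨j, rfl⟩ hne
    have h1 := hinf (fun h => hne (congrArg S h))
    have h2 := sDist_add_two_mul_finrank_inf (S i) (S j)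
    rw [hdim, hdim] at h2
    omega
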